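/- Fix d ≥ 1 and set p = p_c. Suppose the three limits ρ = lim_{t→∞} (−log θ_t)/(log t), η = lim_{t→∞} (log χ_t)/(log t), and ν = lim_{t→∞} (log ξ_t)/(log t) exist as real numbers. Then d·ν ≥ η + 2ρ. -/

import Mathlib

/-!
Common set-up: nearest-neighbour oriented bond percolation on the space-time
lattice `ℤ^d × ℕ`.  A (potential) bond is a pair `((x, s), y)`, representing
the oriented bond from `(x, s)` to `(y, s + 1)` (it is a genuine bond when
`‖x - y‖₁ = 1`).  Each bond is occupied (`true`) with probability `p`,
independently of all other bonds.  The product Bernoulli(`p`) measure on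
configurations is constructed explicitly as the pushforward of the uniform
measure on `[0,1)`: the binary digits of a uniform sample are i.i.d. fair
coin flips, which are re-packed (via the pairing function) into an i.i.d.
sequence of uniform random variables `unif i`, one for each bond, and the
bond indexed by `i` is occupied exactly when `unif i < p`.
-/

open MeasureTheory Filter Set
open scoped Classical ENNReal Topology

namespace OrientedPercolation

/-- A potential bond of the `d`-dimensional space-time lattice: `((x, s), y)`
represents the oriented pair from `(x, s)` to `(y, s + 1)`. -/
abbrev Bond (d : ℕ) := ((Fin d → ℤ) × ℕ) × (Fin d → ℤ)

/-- A bond configuration: each potential bond is occupied (`true`) or vacant (`false`). -/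
abbrev Config (d : ℕ) := Bond d → Bool

/-- The ℓ¹-norm of a point of `ℤ^d`. -/
def norm1 {d : ℕ} (x : Fin d → ℤ) : ℤ := ∑ i, |x i|

/-- The squared Euclidean norm of a point of `ℤ^d`. -/
def normSq {d : ℕ} (x : Fin d → ℤ) : ℤ := ∑ i, (x i) ^ 2

/-- The `n`-th binary digit of `x ∈ [0,1)`. -/
noncomputable def digit (n : ℕ) (x : ℝ) : ℕ := ⌊x * 2 ^ (n + 1)⌋.toNat % 2

/-- From a single uniform sample on `[0,1)`, an i.i.d. sequence of uniform
samples on `[0,1]`, obtained by splitting the binary digits via the pairing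
function. -/
noncomputable def unif (i : ℕ) (x : ℝ) : ℝ :=
  ∑' k : ℕ, (digit (Nat.pair i k) x : ℝ) / 2 ^ (k + 1)

/-- An injective encoding of the bonds by natural numbers. -/
noncomputable def enc (d : ℕ) : Bond d → ℕ := (exists_injective_nat (Bond d)).choose

/-- The i.i.d. Bernoulli(`p`) bond configuration built from a uniform sample `x`. -/
noncomputable def config (d : ℕ) (p : ℝ) (x : ℝ) : Config d :=
  fun b => if unif (enc d b) x < p then true else false

/-- The product Bernoulli(`p`) measure `ℙ_p` on bond configurations. -/
noncomputable def P (d : ℕ) (p : ℝ) : Measure (Config d) :=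
  Measure.map (config d p) ((volume : Measure ℝ).restrict (Set.Ico 0 1))

/-- `ConnectedIn ω R x s y t` : either `(x,s) = (y,t) ∈ R`, or there is a path of
occupied bonds from `(x, s)` to `(y, t)`, all of whose vertices lie in `R`. -/
def ConnectedIn {d : ℕ} (ω : Config d) (R : Set ((Fin d → ℤ) × ℕ))
    (x : Fin d → ℤ) (s : ℕ) (y : Fin d → ℤ) (t : ℕ) : Prop :=
  (x = y ∧ s = t ∧ (x, s) ∈ R) ∨
  (s < t ∧ ∃ v : ℕ → (Fin d → ℤ), v s = x ∧ v t = y ∧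
    (∀ j, s ≤ j → j ≤ t → (v j, j) ∈ R) ∧
    (∀ j, s ≤ j → j < t → norm1 (v (j + 1) - v j) = 1 ∧ ω ((v j, j), v (j + 1)) = true))

/-- `(x, s) → (y, t)` : `(x,s) = (y,t)` or there is a path of occupied bonds from
`(x, s)` to `(y, t)`. -/
def Connected {d : ℕ} (ω : Config d) (x : Fin d → ℤ) (s : ℕ) (y : Fin d → ℤ) (t : ℕ) : Prop :=
  ConnectedIn ω Set.univ x s y t

/-- The survival probability `θ_t = ℙ_p((o,0) → t)`. -/
noncomputable def theta (d : ℕ) (p : ℝ) (t : ℕ) : ℝ :=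
  (P d p {ω | ∃ y, Connected ω 0 0 y t}).toReal

/-- The two-point function `τ(x,t) = ℙ_p((o,0) → (x,t))`. -/
noncomputable def tau (d : ℕ) (p : ℝ) (x : Fin d → ℤ) (t : ℕ) : ℝ :=
  (P d p {ω | Connected ω 0 0 x t}).toReal

/-- The expected number of vertices at time `t` connected from the origin,
`χ_t = Σ_x τ(x,t)`. -/
noncomputable def chi (d : ℕ) (p : ℝ) (t : ℕ) : ℝ := ∑' x : Fin d → ℤ, tau d p x t

/-- The gyration radius `ξ_t = (χ_t⁻¹ Σ_x |x|² τ(x,t))^(1/2)`. -/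
noncomputable def xi (d : ℕ) (p : ℝ) (t : ℕ) : ℝ :=
  Real.sqrt ((∑' x : Fin d → ℤ, (normSq x : ℝ) * tau d p x t) / chi d p t)

/-- The critical point `p_c = inf {p ∈ [0,1] : θ_∞ > 0}` (here `θ_∞ = lim_t θ_t = inf_t θ_t`,
since `θ_t` is nonincreasing in `t` and nonnegative). -/
noncomputable def pc (d : ℕ) : ℝ :=
  sInf {p ∈ Set.Icc (0 : ℝ) 1 | 0 < ⨅ t : ℕ, theta d p t}

/-- The rectangle `[a, b] × [0, t]` (for `d = 1`). -/
def rect (a b : ℤ) (t : ℕ) : Set ((Fin 1 → ℤ) × ℕ) :=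
  {v | a ≤ v.1 0 ∧ v.1 0 ≤ b ∧ v.2 ≤ t}

/-- The rectangle `[a, b] × [0, t]` is crossed vertically: there is a path of occupied
bonds inside the rectangle from some vertex `(x, 0)` to some vertex `(y, t)`. -/
def CrossedVert (ω : Config 1) (a b : ℤ) (t : ℕ) : Prop :=
  ∃ x y : Fin 1 → ℤ, ConnectedIn ω (rect a b t) x 0 y t

/-- The rectangle `[a, b] × [0, t]` is crossed from left to right: there is a path of
occupied bonds inside the rectangle containing a vertex with first coordinate `a` and
a vertex with first coordinate `b`. -/
def CrossedHoriz (ω : Config 1) (a b : ℤ) (t : ℕ) : Prop :=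
  ∃ (x y : Fin 1 → ℤ) (s u : ℕ), x 0 = a ∧ y 0 = b ∧
    (ConnectedIn ω (rect a b t) x s y u ∨ ConnectedIn ω (rect a b t) y u x s)

/-- `V_p(w, t) = ℙ_p([0,w] × [0,t] is crossed vertically)`. -/
noncomputable def V (p : ℝ) (w : ℕ) (t : ℕ) : ℝ :=
  (P 1 p {ω | CrossedVert ω 0 w t}).toReal

/-- `H_p(w, t) = ℙ_p([0,w] × [0,t] is crossed from left to right)`. -/
noncomputable def H (p : ℝ) (w : ℕ) (t : ℕ) : ℝ :=
  (P 1 p {ω | CrossedHoriz ω 0 w t}).toReal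

/-- The event that `(o, 0)` is connected, inside the box `B_o = [-w,w] × [0,t]`, to the
boundary `∂B_o = {(x,s) ∈ B_o : s = t or |x| = w}`. -/
def ToBoundary (ω : Config 1) (w : ℕ) (t : ℕ) : Prop :=
  ∃ (y : Fin 1 → ℤ) (s : ℕ), (s = t ∨ |y 0| = w) ∧
    ConnectedIn ω (rect (-(w : ℤ)) w t) 0 0 y s

/-! ### The law of the configuration -/

/-- fair coin on `{0,1} ⊆ ℕ` -/
noncomputable def coin : Measure ℕ :=
  (2⁻¹ : ℝ≥0∞) • Measure.dirac 0 + (2⁻¹ : ℝ≥0∞) • Measure.dirac 1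

instance coin_prob : IsProbabilityMeasure coin := by
  constructor
  simp [coin, ENNReal.inv_two_add_inv_two]

/-- the uniform measure -/
noncomputable abbrev U : Measure ℝ := (volume : Measure ℝ).restrict (Set.Ico 0 1)

instance U_prob : IsProbabilityMeasure U := by
  constructor
  simp [U]

lemma measurable_digit (n : ℕ) : Measurable (digit n) := by
  unfold digit
  have h1 : Measurable (fun x : ℝ => ⌊x * 2 ^ (n + 1)⌋) :=
    Int.measurable_floor.comp (measurable_id.mul_const _)
  have h2 : Measurable (fun z : ℤ => z.toNat % 2) := measurable_from_top
  exact h2.comp h1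

lemma digit_zero_low {x : ℝ} (h0 : 0 ≤ x) (h1 : x < 1 / 2) : digit 0 x = 0 := by
  have : ⌊x * 2 ^ (0 + 1)⌋ = 0 := by
    rw [Int.floor_eq_iff]; constructor <;> norm_num <;> linarith
  unfold digit; rw [this]; rfl

lemma digit_zero_high {x : ℝ} (h0 : 1 / 2 ≤ x) (h1 : x < 1) : digit 0 x = 1 := by
  have : ⌊x * 2 ^ (0 + 1)⌋ = 1 := by
    rw [Int.floor_eq_iff]; constructor <;> norm_num <;> linarith
  unfold digit; rw [this]; rfl

lemma digit_succ_low (n : ℕ) (x : ℝ) : digit (n + 1) x = digit n (2 * x) := by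
  unfold digit
  have : x * 2 ^ (n + 1 + 1) = 2 * x * 2 ^ (n + 1) := by ring
  rw [this]

lemma digit_succ_high (n : ℕ) {x : ℝ} (hx : 1 / 2 ≤ x) :
    digit (n + 1) x = digit n (2 * x - 1) := by
  unfold digit
  have : x * 2 ^ (n + 1 + 1) = (2 * x - 1) * 2 ^ (n + 1) + ((2 ^ (n + 1) : ℤ) : ℝ) := by
    push_cast; ring
  rw [this, Int.floor_add_intCast]
  have h2 : 0 ≤ ⌊(2 * x - 1) * 2 ^ (n + 1)⌋ := by
    apply Int.floor_nonneg.mpr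
    apply mul_nonneg <;> [linarith; positivity]
  rw [Int.toNat_add h2 (by positivity)]
  have : ((2 : ℤ) ^ (n + 1)).toNat = 2 * 2 ^ n := by
    have : ((2 : ℤ) ^ (n + 1)) = ((2 * 2 ^ n : ℕ) : ℤ) := by push_cast; ring
    rw [this, Int.toNat_natCast]
  rw [this]
  omega

lemma vol_low {B : Set ℝ} :
    volume (Set.Ico 0 (1 / 2) ∩ (fun x : ℝ => 2 * x) ⁻¹' B) =
      2⁻¹ * volume (Set.Ico 0 1 ∩ B) := by
  have : Set.Ico (0 : ℝ) (1 / 2) ∩ (fun x : ℝ => 2 * x) ⁻¹' B =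
      (fun x : ℝ => 2 * x) ⁻¹' (Set.Ico 0 1 ∩ B) := by
    ext x
    simp only [Set.mem_inter_iff, Set.mem_Ico, Set.mem_preimage]
    constructor
    · rintro ⟨⟨a, b⟩, c⟩; exact ⟨⟨by linarith, by linarith⟩, c⟩
    · rintro ⟨⟨a, b⟩, c⟩; exact ⟨⟨by linarith, by linarith⟩, c⟩
  rw [this, Real.volume_preimage_mul_left (by norm_num)]
  congr 1
  rw [abs_of_pos (by norm_num), ENNReal.ofReal_inv_of_pos (by norm_num)]
  simp

lemma vol_high {B : Set ℝ} :
    volume (Set.Ico (1 / 2) 1 ∩ (fun x : ℝ => 2 * x - 1) ⁻¹' B) =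
      2⁻¹ * volume (Set.Ico 0 1 ∩ B) := by
  rw [← vol_low]
  have : Set.Ico (1 / 2 : ℝ) 1 ∩ (fun x : ℝ => 2 * x - 1) ⁻¹' B =
      (fun x : ℝ => x + (-1 / 2)) ⁻¹' (Set.Ico 0 (1 / 2) ∩ (fun x : ℝ => 2 * x) ⁻¹' B) := by
    ext x
    simp only [Set.mem_inter_iff, Set.mem_Ico, Set.mem_preimage]
    have : 2 * (x + -1 / 2) = 2 * x - 1 := by ring
    rw [this]
    constructor
    · rintro ⟨⟨a, b⟩, c⟩; exact ⟨⟨by linarith, by linarith⟩, c⟩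
    · rintro ⟨⟨a, b⟩, c⟩; exact ⟨⟨by linarith, by linarith⟩, c⟩
  rw [this, measure_preimage_add_right]

lemma digits_prefix (N : ℕ) : ∀ t : ℕ → Set ℕ,
    U {x | ∀ k < N, digit k x ∈ t k} = ∏ k ∈ Finset.range N, coin (t k) := by
  induction N with
  | zero => intro t; simp
  | succ N ih =>
    intro t
    have hm : ∀ t : ℕ → Set ℕ, ∀ N, MeasurableSet {x : ℝ | ∀ k < N, digit k x ∈ t k} := by
      intro t N
      have : {x : ℝ | ∀ k < N, digit k x ∈ t k} = ⋂ k, ⋂ (_ : k < N), digit k ⁻¹' (t k) := by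
        ext; simp
      rw [this]
      exact MeasurableSet.iInter fun k => MeasurableSet.iInter fun _ =>
        measurable_digit k (MeasurableSet.of_discrete)
    rw [Finset.prod_range_succ', ← ih (fun k => t (k + 1))]
    set B := {x : ℝ | ∀ k < N, digit k x ∈ t (k + 1)} with hB
    rw [Measure.restrict_apply (hm _ _), Measure.restrict_apply (hm _ _)]
    have hsplit : {x : ℝ | ∀ k < N + 1, digit k x ∈ t k} ∩ Set.Ico 0 1 =
        ({x | x ∈ Set.Ico 0 (1 / 2) ∩ (fun x : ℝ => 2 * x) ⁻¹' B ∧ 0 ∈ t 0}) ∪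
        ({x | x ∈ Set.Ico (1 / 2) 1 ∩ (fun x : ℝ => 2 * x - 1) ⁻¹' B ∧ 1 ∈ t 0}) := by
      ext x
      simp only [Set.mem_inter_iff, Set.mem_ofPred_eq, Set.mem_Ico, Set.mem_union,
        Set.mem_preimage, hB]
      have hk : (∀ k < N + 1, digit k x ∈ t k) ↔
          digit 0 x ∈ t 0 ∧ ∀ k < N, digit (k + 1) x ∈ t (k + 1) := by
        constructor
        · intro h; exact ⟨h 0 (by omega), fun k hk => h (k + 1) (by omega)⟩
        · rintro ⟨h0, h1⟩ k hk
          cases k with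
          | zero => exact h0
          | succ k => exact h1 k (by omega)
      rw [hk]
      rcases lt_or_ge x (1 / 2) with hx | hx
      · have h2 : ¬ (1 / 2 ≤ x) := not_le.mpr hx
        simp only [digit_succ_low, h2, hx, false_and, or_false, and_true]
        constructor
        · rintro ⟨⟨a, b⟩, c, e⟩
          rw [digit_zero_low c hx] at a
          exact ⟨⟨c, b⟩, a⟩
        · rintro ⟨⟨c, b⟩, a⟩
          rw [digit_zero_low c hx]
          exact ⟨⟨a, b⟩, c, by linarith⟩
      · have h2 : ¬ (x < 1 / 2) := not_lt.mpr hx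
        simp only [digit_succ_high _ hx, h2, hx, and_false, false_and, false_or, true_and]
        constructor
        · rintro ⟨⟨a, b⟩, c, e⟩
          rw [digit_zero_high hx e] at a
          exact ⟨⟨e, b⟩, a⟩
        · rintro ⟨⟨c, b⟩, a⟩
          rw [digit_zero_high hx c]
          exact ⟨⟨a, b⟩, by linarith, c⟩
    have hBm : MeasurableSet B := hm (fun k => t (k + 1)) N
    have hm2 : MeasurableSet {x | x ∈ Set.Ico (1 / 2) 1 ∩ (fun x : ℝ => 2 * x - 1) ⁻¹' B ∧ 1 ∈ t 0} := by
      by_cases h : 1 ∈ t 0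
      · simp only [h, and_true, Set.ofPred_mem_eq]
        have hf : Measurable (fun x : ℝ => 2 * x - 1) := by fun_prop
        exact measurableSet_Ico.inter (hf hBm)
      · simp [h]
    have hd : Disjoint {x | x ∈ Set.Ico 0 (1 / 2) ∩ (fun x : ℝ => 2 * x) ⁻¹' B ∧ 0 ∈ t 0}
        {x | x ∈ Set.Ico (1 / 2) 1 ∩ (fun x : ℝ => 2 * x - 1) ⁻¹' B ∧ 1 ∈ t 0} := by
      rw [Set.disjoint_left]
      rintro x ⟨⟨⟨_, h⟩, _⟩, _⟩ ⟨⟨⟨h', _⟩, _⟩, _⟩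
      linarith
    rw [hsplit, measure_union hd hm2]
    have e0 : volume {x | x ∈ Set.Ico 0 (1 / 2) ∩ (fun x : ℝ => 2 * x) ⁻¹' B ∧ 0 ∈ t 0} =
        2⁻¹ * (Measure.dirac 0 (t 0)) * volume (Set.Ico 0 1 ∩ B) := by
      by_cases h : 0 ∈ t 0
      · simp only [h, and_true, Set.ofPred_mem_eq, vol_low]; simp [h]
      · simp [h]
    have e1 : volume {x | x ∈ Set.Ico (1 / 2) 1 ∩ (fun x : ℝ => 2 * x - 1) ⁻¹' B ∧ 1 ∈ t 0} =
        2⁻¹ * (Measure.dirac 1 (t 0)) * volume (Set.Ico 0 1 ∩ B) := by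
      by_cases h : 1 ∈ t 0
      · simp only [h, and_true, Set.ofPred_mem_eq, vol_high]; simp [h]
      · simp [h]
    rw [e0, e1, Set.inter_comm B]
    simp only [coin, Measure.add_apply, Measure.smul_apply, smul_eq_mul]
    ring

lemma digits_law : Measure.map (fun (x : ℝ) (k : ℕ) => digit k x) U =
    Measure.infinitePi (fun _ : ℕ => coin) := by
  apply Measure.eq_infinitePi
  intro s t ht
  rw [Measure.map_apply (measurable_pi_iff.mpr measurable_digit)
    (.pi s.countable_toSet fun _ _ => ht _)]
  obtain ⟨N, hN⟩ : ∃ N, s ⊆ Finset.range N := by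
    obtain ⟨N, hN⟩ := s.exists_nat_subset_range
    exact ⟨N, hN⟩
  have := digits_prefix N (fun k => if k ∈ s then t k else Set.univ)
  rw [← Finset.prod_subset (s₁ := s) hN] at this
  · have h2 : ∏ x ∈ s, coin (if x ∈ s then t x else Set.univ) = ∏ x ∈ s, coin (t x) :=
      Finset.prod_congr rfl fun x hx => by simp [hx]
    rw [← h2, ← this]
    congr 1
    ext x
    simp only [Set.mem_preimage, Set.mem_pi, Finset.mem_coe, Set.mem_ofPred_eq]
    constructor
    · intro h k _
      by_cases hk : k ∈ s
      · simpa [hk] using h k hk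
      · simp [hk]
    · intro h k hk
      simpa [hk] using h k (Finset.mem_range.mp (hN hk))
  · intro x _ hx
    simp [hx]

/-- measurable version of the binary sum -/
noncomputable def binsum (a : ℕ → ℕ) : ℝ :=
  ((∑' k : ℕ, (((a k % 2 : ℕ) : NNReal) / 2 ^ (k + 1)) : NNReal) : ℝ)

lemma measurable_binsum : Measurable binsum := by
  unfold binsum
  apply Measurable.coe_nnreal_real
  apply Measurable.tsum
  intro k
  have : Measurable (fun n : ℕ => (((n % 2 : ℕ) : NNReal) / 2 ^ (k + 1))) := measurable_from_top
  exact this.comp (measurable_pi_apply k)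

lemma unif_eq (i : ℕ) (x : ℝ) : unif i x = binsum (fun k => digit (Nat.pair i k) x) := by
  unfold unif binsum
  rw [NNReal.coe_tsum]
  congr 1
  ext k
  have : digit (Nat.pair i k) x % 2 = digit (Nat.pair i k) x := by
    unfold digit; omega
  rw [this]
  simp

/-- the one-bond state as a function of the digits -/
noncomputable def bit (p : ℝ) (a : ℕ → ℕ) : Bool := if binsum a < p then true else false

lemma measurable_bit (p : ℝ) : Measurable (bit p) := by
  unfold bit
  exact Measurable.ite (measurableSet_lt measurable_binsum measurable_const)
    measurable_const measurable_const

/-- one-bond law -/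
noncomputable def bern (p : ℝ) : Measure Bool :=
  (Measure.infinitePi (fun _ : ℕ => coin)).map (bit p)

instance bern_prob (p : ℝ) : IsProbabilityMeasure (bern p) :=
  Measure.isProbabilityMeasure_map (measurable_bit p).aemeasurable

lemma P_eq (d : ℕ) (p : ℝ) : P d p = Measure.infinitePi (fun _ : Bond d => bern p) := by
  have henc : Function.Injective (enc d) := (exists_injective_nat (Bond d)).choose_spec
  have hg : Function.Injective (fun q : Bond d × ℕ => Nat.pair (enc d q.1) q.2) := by
    rintro ⟨a, b⟩ ⟨a', b'⟩ h
    have := Nat.pair_eq_pair.mp h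
    exact Prod.ext (henc this.1) this.2
  have hD : Measurable (fun (x : ℝ) (k : ℕ) => digit k x) :=
    measurable_pi_iff.mpr measurable_digit
  have h1 := Measure.map_infinitePi_infinitePi_of_inj (P := fun _ : ℕ => coin) hg
  have h2 := Measure.infinitePi_map_curry (fun (_ : Bond d) (_ : ℕ) => coin)
  have h3 := Measure.infinitePi_map_pi (μ := fun _ : Bond d => Measure.infinitePi fun _ : ℕ => coin)
    (f := fun _ => bit p) (fun _ => measurable_bit p)
  have hm1 : Measurable (fun (a : ℕ → ℕ) (q : Bond d × ℕ) => a (Nat.pair (enc d q.1) q.2)) := by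
    fun_prop
  have hm3 : Measurable (fun (a : Bond d → ℕ → ℕ) (b : Bond d) => bit p (a b)) :=
    measurable_pi_iff.mpr fun b => (measurable_bit p).comp (measurable_pi_apply b)
  unfold bern
  rw [← h3, ← h2, ← h1, ← digits_law, Measure.map_map hm1 hD,
    Measure.map_map (by fun_prop) (hm1.comp hD),
    Measure.map_map hm3 (Measurable.comp (by fun_prop) (hm1.comp hD))]
  unfold P
  congr 1
  ext x b
  simp only [config, unif_eq]
  rfl

instance P_prob (d : ℕ) (p : ℝ) : IsProbabilityMeasure (P d p) := by
  rw [P_eq]; infer_instance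

/-! ### Paths -/

lemma connected_iff {d : ℕ} (ω : Config d) (x : Fin d → ℤ) (s : ℕ) (y : Fin d → ℤ) (t : ℕ) :
    Connected ω x s y t ↔ s ≤ t ∧ ∃ v : ℕ → (Fin d → ℤ), v s = x ∧ v t = y ∧
      ∀ j, s ≤ j → j < t → norm1 (v (j + 1) - v j) = 1 ∧ ω ((v j, j), v (j + 1)) = true := by
  unfold Connected ConnectedIn
  constructor
  · rintro (⟨rfl, rfl, _⟩ | ⟨h, v, h1, h2, _, h3⟩)
    · exact ⟨le_rfl, fun _ => x, rfl, rfl, fun j h1 h2 => by omega⟩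
    · exact ⟨h.le, v, h1, h2, h3⟩
  · rintro ⟨h, v, h1, h2, h3⟩
    rcases h.eq_or_lt with rfl | h
    · left; exact ⟨h1.symm.trans h2, rfl, trivial⟩
    · right; exact ⟨h, v, h1, h2, fun _ _ _ => trivial, h3⟩

lemma connected_self {d : ℕ} (ω : Config d) (x y : Fin d → ℤ) (s : ℕ) :
    Connected ω x s y s ↔ x = y := by
  rw [connected_iff]
  constructor
  · rintro ⟨_, v, rfl, rfl, _⟩; rfl
  · rintro rfl; exact ⟨le_rfl, fun _ => x, rfl, rfl, fun j h1 h2 => by omega⟩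

lemma connected_succ {d : ℕ} (ω : Config d) (x y : Fin d → ℤ) {s t : ℕ} (hst : s ≤ t) :
    Connected ω x s y (t + 1) ↔
      ∃ z, Connected ω x s z t ∧ norm1 (y - z) = 1 ∧ ω ((z, t), y) = true := by
  simp only [connected_iff]
  constructor
  · rintro ⟨_, v, h1, rfl, h3⟩
    exact ⟨v t, ⟨hst, v, h1, rfl, fun j a b => h3 j a (by omega)⟩, h3 t hst (by omega)⟩
  · rintro ⟨z, ⟨_, v, h1, rfl, h3⟩, h4⟩
    refine ⟨by omega, Function.update v (t + 1) y, ?_, by simp, ?_⟩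
    · rw [Function.update_of_ne (by omega)]; exact h1
    · intro j a b
      rw [Function.update_of_ne (a := j) (by omega)]
      rcases (Nat.lt_succ_iff.mp b).eq_or_lt with rfl | hj
      · simpa using h4
      · rw [Function.update_of_ne (by omega)]
        exact h3 j a hj

lemma connected_split {d : ℕ} {ω : Config d} {x y : Fin d → ℤ} {s t : ℕ}
    (h : Connected ω x s y t) {n : ℕ} (h1 : s ≤ n) (h2 : n ≤ t) :
    ∃ z, Connected ω x s z n ∧ Connected ω z n y t := by
  simp only [connected_iff] at h ⊢
  obtain ⟨_, v, a, b, c⟩ := h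
  exact ⟨v n, ⟨h1, v, a, rfl, fun j _ _ => c j (by omega) (by omega)⟩,
    ⟨h2, v, rfl, b, fun j _ _ => c j (by omega) (by omega)⟩⟩

lemma measurable_connected {d : ℕ} (m : MeasurableSpace (Config d)) (x : Fin d → ℤ) (s : ℕ) :
    ∀ (k : ℕ) (y : Fin d → ℤ),
    (∀ b : Bond d, s ≤ b.1.2 → b.1.2 < s + k → MeasurableSet[m] {ω | ω b = true}) →
    MeasurableSet[m] {ω | Connected ω x s y (s + k)} := by
  intro k
  induction k with
  | zero =>
    intro y _
    simp only [add_zero, connected_self]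
    exact MeasurableSet.const _
  | succ k ih =>
    intro y hb
    have : {ω : Config d | Connected ω x s y (s + (k + 1))} =
        ⋃ z, ({ω | Connected ω x s z (s + k)} ∩
          ({ω | norm1 (y - z) = 1} ∩ {ω | ω ((z, s + k), y) = true})) := by
      ext ω
      simp only [Set.mem_iUnion, Set.mem_inter_iff, Set.mem_ofPred_eq]
      exact connected_succ ω x y (Nat.le_add_right s k)
    rw [this]
    refine MeasurableSet.iUnion fun z => ?_
    refine MeasurableSet.inter (ih z fun b h1 h2 => hb b h1 (by omega)) ?_
    exact MeasurableSet.inter (MeasurableSet.const _) (hb _ (by simp) (by simp))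

/-- the survival event -/
def Surv (d n : ℕ) : Set (Config d) := {ω | ∃ y, Connected ω 0 0 y n}

/-- the backward survival event from time `T` down to time `n` -/
def BSurv {d : ℕ} (a : Fin d → ℤ) (n T : ℕ) : Set (Config d) := {ω | ∃ y, Connected ω y n a T}

lemma measurable_surv {d : ℕ} (m : MeasurableSpace (Config d)) (n : ℕ)
    (hb : ∀ b : Bond d, b.1.2 < n → MeasurableSet[m] {ω | ω b = true}) :
    MeasurableSet[m] (Surv d n) := by
  have : Surv d n = ⋃ y, {ω | Connected ω 0 0 y (0 + n)} := by
    ext ω; simp [Surv]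
  rw [this]
  exact MeasurableSet.iUnion fun y =>
    measurable_connected m 0 0 n y fun b _ h => hb b (by omega)

lemma measurable_bsurv {d : ℕ} (m : MeasurableSpace (Config d)) (a : Fin d → ℤ) (n k : ℕ)
    (hb : ∀ b : Bond d, n ≤ b.1.2 → MeasurableSet[m] {ω | ω b = true}) :
    MeasurableSet[m] (BSurv a n (n + k)) := by
  have : BSurv a n (n + k) = ⋃ y, {ω | Connected ω y n a (n + k)} := by
    ext ω; simp [BSurv]
  rw [this]
  exact MeasurableSet.iUnion fun y =>
    measurable_connected m y n k a fun b h _ => hb b (by omega)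

lemma measurable_coord {d : ℕ} (b : Bond d) : MeasurableSet {ω : Config d | ω b = true} :=
  (measurable_pi_apply b : Measurable fun ω : Config d => ω b)
    (MeasurableSet.singleton true)

/-- Events before and after time `n` are independent. -/
lemma indep_surv (d : ℕ) (p : ℝ) (a : Fin d → ℤ) (n k : ℕ) :
    P d p (Surv d n ∩ BSurv a n (n + k)) = P d p (Surv d n) * P d p (BSurv a n (n + k)) := by
  have hi : ProbabilityTheory.iIndepFun (fun (b : Bond d) (ω : Config d) => ω b) (P d p) := by
    rw [P_eq]
    exact ProbabilityTheory.iIndepFun_infinitePi (X := fun _ x => x) (fun _ => measurable_id)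
  have h := ProbabilityTheory.indep_iSup_of_disjoint
    (m := fun b : Bond d => MeasurableSpace.comap (fun ω : Config d => ω b) inferInstance)
    (fun b => (measurable_pi_apply b).comap_le) hi
    (S := {b : Bond d | b.1.2 < n}) (T := {b : Bond d | n ≤ b.1.2})
    (by
      rw [Set.disjoint_left]
      intro b h1 h2
      simp only [Set.mem_ofPred_eq] at h1 h2
      omega)
  rw [ProbabilityTheory.Indep_iff] at h
  have key : ∀ (S : Set (Bond d)), ∀ b ∈ S, MeasurableSet[⨆ b ∈ S,
      MeasurableSpace.comap (fun ω : Config d => ω b) inferInstance] {ω | ω b = true} := by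
    intro S b hb
    refine (le_iSup₂ (f := fun b (_ : b ∈ S) =>
      MeasurableSpace.comap (fun ω : Config d => ω b) inferInstance) b hb) _ ?_
    exact ⟨{true}, MeasurableSet.singleton true, rfl⟩
  refine h _ _ ?_ ?_
  · refine measurable_surv _ n fun b hb => ?_
    exact key _ b hb
  · refine measurable_bsurv _ a n k fun b hb => ?_
    exact key _ b hb

/-- time reversal and translation of bonds -/
def rev {d : ℕ} (a : Fin d → ℤ) (T : ℕ) (b : Bond d) : Bond d :=
  if b.1.2 < T then ((a - b.2, T - 1 - b.1.2), a - b.1.1) else b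

lemma rev_rev {d : ℕ} (a : Fin d → ℤ) (T : ℕ) : Function.Involutive (rev (d := d) a T) := by
  rintro ⟨⟨x, s⟩, y⟩
  unfold rev
  by_cases h : s < T
  · have h2 : T - 1 - s < T := by omega
    have h3 : T - 1 - (T - 1 - s) = s := by omega
    simp [h, h2, h3]
  · simp [h]

lemma norm1_neg {d : ℕ} (x : Fin d → ℤ) : norm1 (-x) = norm1 x := by
  simp [norm1]

lemma bsurv_iff {d : ℕ} (a : Fin d → ℤ) (n k : ℕ) (ω : Config d) :
    ω ∈ BSurv a n (n + k) ↔ (fun b => ω (rev a (n + k) b)) ∈ Surv d k := by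
  simp only [BSurv, Surv, Set.mem_ofPred_eq, connected_iff]
  constructor
  · rintro ⟨y, _, v, h1, h2, h3⟩
    refine ⟨a - y, by omega, fun j => a - v (n + k - j), by simp [h2], by simp [h1], ?_⟩
    intro j _ hj
    have h4 := h3 (n + k - (j + 1)) (by omega) (by omega)
    have h5 : n + k - (j + 1) + 1 = n + k - j := by omega
    have h6 : n + k - 1 - j = n + k - (j + 1) := by omega
    have h7 : j < n + k := by omega
    rw [h5] at h4
    simp only [rev, h7, if_true, h6, sub_sub_cancel, sub_sub_sub_cancel_left]
    exact h4
  · rintro ⟨y, _, v, h1, h2, h3⟩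
    refine ⟨a - y, by omega, fun j => a - v (n + k - j), by simp [h2], by simp [h1], ?_⟩
    intro j hn hj
    have h4 := h3 (n + k - (j + 1)) (by omega) (by omega)
    have h5 : n + k - (j + 1) + 1 = n + k - j := by omega
    have h6 : n + k - 1 - (n + k - (j + 1)) = j := by omega
    have h7 : n + k - (j + 1) < n + k := by omega
    rw [h5] at h4
    simp only [rev, h7, if_true, h6] at h4
    simp only [sub_sub_sub_cancel_left]
    exact h4

lemma P_bsurv (d : ℕ) (p : ℝ) (a : Fin d → ℤ) (n k : ℕ) :
    P d p (BSurv a n (n + k)) = P d p (Surv d k) := by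
  have h := Measure.map_infinitePi_infinitePi_of_inj (P := fun _ : Bond d => bern p)
    (rev_rev a (n + k)).injective
  rw [← P_eq] at h
  have hm : MeasurableSet (Surv d k) := measurable_surv _ k fun b _ => measurable_coord b
  have hset : BSurv a n (n + k) = (fun (ω : Config d) b => ω (rev a (n + k) b)) ⁻¹' (Surv d k) := by
    ext ω; exact bsurv_iff a n k ω
  rw [hset, ← Measure.map_apply (by fun_prop) hm, h]

lemma tau_le (d : ℕ) (p : ℝ) (a : Fin d → ℤ) (n k : ℕ) :
    tau d p a (n + k) ≤ theta d p n * theta d p k := by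
  have h : P d p {ω | Connected ω 0 0 a (n + k)} ≤ P d p (Surv d n) * P d p (Surv d k) := by
    rw [← P_bsurv d p a n k, ← indep_surv]
    apply measure_mono
    intro ω hω
    obtain ⟨z, h1, h2⟩ := connected_split hω (n := n) (by omega) (by omega)
    exact ⟨⟨z, h1⟩, ⟨z, h2⟩⟩
  unfold tau theta
  rw [← ENNReal.toReal_mul]
  exact ENNReal.toReal_mono (by finiteness) h

lemma theta_nonneg (d : ℕ) (p : ℝ) (t : ℕ) : 0 ≤ theta d p t := ENNReal.toReal_nonneg

lemma tau_nonneg (d : ℕ) (p : ℝ) (x : Fin d → ℤ) (t : ℕ) : 0 ≤ tau d p x t :=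
  ENNReal.toReal_nonneg

lemma theta_anti (d : ℕ) (p : ℝ) {s t : ℕ} (h : s ≤ t) : theta d p t ≤ theta d p s := by
  unfold theta
  refine ENNReal.toReal_mono (by finiteness) (measure_mono ?_)
  rintro ω ⟨y, hy⟩
  obtain ⟨z, h1, _⟩ := connected_split hy (n := s) (by omega) h
  exact ⟨z, h1⟩

lemma tau_le_theta (d : ℕ) (p : ℝ) (x : Fin d → ℤ) (t : ℕ) : tau d p x t ≤ theta d p t := by
  unfold theta tau
  refine ENNReal.toReal_mono (by finiteness) (measure_mono ?_)
  rintro ω hy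
  exact ⟨x, hy⟩

/-! ### Support -/

lemma abs_le_norm1 {d : ℕ} (x : Fin d → ℤ) (i : Fin d) : |x i| ≤ norm1 x :=
  Finset.single_le_sum (f := fun i => |x i|) (fun _ _ => abs_nonneg _) (Finset.mem_univ i)

lemma connected_bound {d : ℕ} (ω : Config d) (i : Fin d) : ∀ (t : ℕ) (y : Fin d → ℤ),
    Connected ω 0 0 y t → |y i| ≤ t := by
  intro t
  induction t with
  | zero => intro y h; rw [connected_self] at h; simp [← h]
  | succ t ih =>
    intro y h
    rw [connected_succ ω _ _ (by omega)] at h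
    obtain ⟨z, h1, h2, _⟩ := h
    have a := ih z h1
    have b := abs_le_norm1 (y - z) i
    rw [h2] at b
    simp only [Pi.sub_apply] at b
    rw [abs_le] at a b ⊢
    push_cast
    constructor <;> linarith

lemma norm1_parity {d : ℕ} (x : Fin d → ℤ) : (2 : ℤ) ∣ norm1 x - ∑ i, x i := by
  unfold norm1
  rw [← Finset.sum_sub_distrib]
  refine Finset.dvd_sum fun i _ => ?_
  rcases abs_cases (x i) with h | h <;> omega

lemma connected_parity {d : ℕ} (ω : Config d) : ∀ (t : ℕ) (y : Fin d → ℤ),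
    Connected ω 0 0 y t → (2 : ℤ) ∣ (∑ i, y i) - t := by
  intro t
  induction t with
  | zero => intro y h; rw [connected_self] at h; simp [← h]
  | succ t ih =>
    intro y h
    rw [connected_succ ω _ _ (by omega)] at h
    obtain ⟨z, h1, h2, _⟩ := h
    have a := ih z h1
    have b := norm1_parity (y - z)
    rw [h2] at b
    simp only [Pi.sub_apply, Finset.sum_sub_distrib] at b
    push_cast
    omega

/-- the cube `[-T,T]^d` -/
noncomputable def cube (d T : ℕ) : Finset (Fin d → ℤ) := Fintype.piFinset fun _ => Finset.Icc (-(T : ℤ)) T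

lemma mem_cube {d T : ℕ} {x : Fin d → ℤ} : x ∈ cube d T ↔ ∀ i, |x i| ≤ T := by
  simp [cube, abs_le]

lemma card_cube (d T : ℕ) : (cube d T).card = (2 * T + 1) ^ d := by
  simp only [cube, Fintype.card_piFinset, Int.card_Icc, Finset.prod_const, Finset.card_univ,
    Fintype.card_fin]
  congr 1
  omega

lemma tau_eq_zero {d : ℕ} {p : ℝ} {x : Fin d → ℤ} {t : ℕ} (h : ∀ ω : Config d, ¬ Connected ω 0 0 x t) :
    tau d p x t = 0 := by
  simp [tau, h]

lemma tau_supp {d : ℕ} {p : ℝ} {x : Fin d → ℤ} {t : ℕ} (h : x ∉ cube d t) : tau d p x t = 0 := by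
  apply tau_eq_zero
  intro ω hω
  exact h (mem_cube.mpr fun i => connected_bound ω i t x hω)

lemma chi_eq (d : ℕ) (p : ℝ) (t : ℕ) : chi d p t = ∑ x ∈ cube d t, tau d p x t :=
  tsum_eq_sum fun _ h => tau_supp h

lemma moment_eq (d : ℕ) (p : ℝ) (t : ℕ) :
    ∑' x : Fin d → ℤ, (normSq x : ℝ) * tau d p x t =
      ∑ x ∈ cube d t, (normSq x : ℝ) * tau d p x t :=
  tsum_eq_sum fun _ h => by rw [tau_supp h, mul_zero]

lemma theta_le_chi (d : ℕ) (p : ℝ) (t : ℕ) : theta d p t ≤ chi d p t := by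
  rw [chi_eq]
  unfold theta tau
  rw [← ENNReal.toReal_sum (by intros; finiteness)]
  refine ENNReal.toReal_mono (ENNReal.sum_ne_top.mpr (by intros; finiteness)) ?_
  refine le_trans (measure_mono ?_) (measure_biUnion_finset_le _ _)
  rintro ω ⟨y, hy⟩
  simp only [Set.mem_iUnion]
  exact ⟨y, mem_cube.mpr fun i => connected_bound ω i t y hy, hy⟩

lemma normSq_nonneg {d : ℕ} (x : Fin d → ℤ) : 0 ≤ normSq x :=
  Finset.sum_nonneg fun _ _ => sq_nonneg _

lemma sq_le_normSq {d : ℕ} (x : Fin d → ℤ) (i : Fin d) : x i ^ 2 ≤ normSq x :=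
  Finset.single_le_sum (f := fun i => x i ^ 2) (fun _ _ => sq_nonneg _) (Finset.mem_univ i)

lemma tau_le_normSq {d : ℕ} (p : ℝ) (x : Fin d → ℤ) (n : ℕ) :
    tau d p x (n + (n + 1)) ≤ (normSq x : ℝ) * tau d p x (n + (n + 1)) := by
  by_cases h : ∃ ω : Config d, Connected ω 0 0 x (n + (n + 1))
  · obtain ⟨ω, hω⟩ := h
    have hp := connected_parity ω _ _ hω
    have h1 : 1 ≤ normSq x := by
      by_contra hlt
      have h0 : normSq x = 0 := by have := normSq_nonneg x; omega
      have hx : ∀ i, x i = 0 := fun i => by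
        have := sq_le_normSq x i
        rw [h0] at this
        exact pow_eq_zero_iff (two_ne_zero) |>.mp (le_antisymm this (sq_nonneg _))
      simp only [hx, Finset.sum_const_zero] at hp
      push_cast at hp
      omega
    have h2 : (1 : ℝ) ≤ normSq x := by exact_mod_cast h1
    exact le_mul_of_one_le_left (tau_nonneg _ _ _ _) h2
  · rw [tau_eq_zero (not_exists.mp h), mul_zero]

lemma xi_ge_one {d : ℕ} {p : ℝ} {n : ℕ} (hpos : 0 < theta d p (n + (n + 1))) :
    1 ≤ xi d p (n + (n + 1)) := by
  unfold xi
  rw [Real.one_le_sqrt, one_le_div (hpos.trans_le (theta_le_chi _ _ _)), moment_eq, chi_eq]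
  exact Finset.sum_le_sum fun x _ => tau_le_normSq p x n

lemma main_bound {d : ℕ} {p : ℝ} {n : ℕ} (hpos : 0 < theta d p (n + (n + 1))) :
    chi d p (n + (n + 1)) ≤
      2 * 5 ^ d * xi d p (n + (n + 1)) ^ d * theta d p n ^ 2 := by
  have hchi : 0 < chi d p (n + (n + 1)) := hpos.trans_le (theta_le_chi _ _ _)
  have hxi := xi_ge_one hpos
  have hsq : xi d p (n + (n + 1)) ^ 2 * chi d p (n + (n + 1)) =
      ∑ x ∈ cube d (n + (n + 1)), (normSq x : ℝ) * tau d p x (n + (n + 1)) := by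
    unfold xi
    rw [Real.sq_sqrt, moment_eq, div_mul_cancel₀ _ hchi.ne']
    rw [moment_eq]
    refine div_nonneg (Finset.sum_nonneg fun x _ => mul_nonneg ?_ (tau_nonneg _ _ _ _)) hchi.le
    exact_mod_cast normSq_nonneg x
  have hth : ∀ x, tau d p x (n + (n + 1)) ≤ theta d p n ^ 2 := fun x =>
    (tau_le d p x n (n + 1)).trans (by
      rw [sq]; exact mul_le_mul_of_nonneg_left (theta_anti d p (by omega)) (theta_nonneg _ _ _))
  set ξ := xi d p (n + (n + 1)) with hξ
  set T := n + (n + 1) with hT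
  have hle : ∀ x ∈ cube d T, tau d p x T ≤
      (if x ∈ cube d ⌊2 * ξ⌋₊ then theta d p n ^ 2 else 0) +
        (normSq x : ℝ) * tau d p x T / (4 * ξ ^ 2) := by
    intro x _
    have hns : (0 : ℝ) ≤ normSq x := by exact_mod_cast normSq_nonneg x
    split_ifs with hx
    · have := tau_nonneg d p x T
      have : 0 ≤ (normSq x : ℝ) * tau d p x T / (4 * ξ ^ 2) := by positivity
      linarith [hth x]
    · rw [zero_add, le_div_iff₀ (by positivity), mul_comm]
      refine mul_le_mul_of_nonneg_right ?_ (tau_nonneg _ _ _ _)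
      rw [mem_cube] at hx
      push Not at hx
      obtain ⟨i, hi⟩ := hx
      have h1 : (2 * ξ) < |(x i : ℝ)| := by
        have h3 : ⌊2 * ξ⌋₊ < (x i).natAbs := by
          rw [Int.abs_eq_natAbs] at hi
          exact_mod_cast hi
        have := (Nat.floor_lt (by positivity)).mp h3
        rwa [Nat.cast_natAbs, Int.cast_abs] at this
      have h2 : ((x i : ℝ)) ^ 2 ≤ normSq x := by exact_mod_cast sq_le_normSq x i
      rw [← sq_abs] at h2
      nlinarith
  have hsum := Finset.sum_le_sum hle
  rw [← chi_eq, Finset.sum_add_distrib, ← Finset.sum_div, ← hsq] at hsum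
  have h4 : ξ ^ 2 * chi d p T / (4 * ξ ^ 2) = chi d p T / 4 := by
    field_simp
  have h5 : ∑ x ∈ cube d T, (if x ∈ cube d ⌊2 * ξ⌋₊ then theta d p n ^ 2 else 0) ≤
      5 ^ d * ξ ^ d * theta d p n ^ 2 := by
    rw [← Finset.sum_filter, Finset.sum_const, nsmul_eq_mul]
    refine mul_le_mul_of_nonneg_right ?_ (sq_nonneg _)
    have hc : ((cube d T).filter (fun x => x ∈ cube d ⌊2 * ξ⌋₊)).card ≤ (2 * ⌊2 * ξ⌋₊ + 1) ^ d := by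
      rw [← card_cube]
      exact Finset.card_le_card fun x hx => (Finset.mem_filter.mp hx).2
    have hc' : (((cube d T).filter (fun x => x ∈ cube d ⌊2 * ξ⌋₊)).card : ℝ) ≤
        (2 * (⌊2 * ξ⌋₊ : ℝ) + 1) ^ d := by exact_mod_cast hc
    refine hc'.trans ?_
    rw [← mul_pow]
    have := Nat.floor_le (show 0 ≤ 2 * ξ by positivity)
    exact pow_le_pow_left₀ (by positivity) (by linarith) _
  rw [h4] at hsum
  nlinarith

/-! ### Limits -/

lemma tendsto_log_nat : Tendsto (fun n : ℕ => Real.log n) atTop atTop :=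
  Real.tendsto_log_atTop.comp tendsto_natCast_atTop_atTop

lemma tendsto_odd : Tendsto (fun n : ℕ => n + (n + 1)) atTop atTop :=
  tendsto_atTop_mono (fun n => by simp only [id]; omega) tendsto_id

lemma tendsto_log_ratio :
    Tendsto (fun n : ℕ => Real.log n / Real.log ((n + (n + 1) : ℕ) : ℝ)) atTop (𝓝 1) := by
  have h : Tendsto (fun n : ℕ => Real.log ((n + (n + 1) : ℕ) : ℝ) / Real.log n) atTop (𝓝 1) := by
    have hup : Tendsto (fun n : ℕ => Real.log 3 / Real.log n + 1) atTop (𝓝 1) := by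
      have := (tendsto_const_nhds (x := Real.log 3)).div_atTop tendsto_log_nat
      simpa using this.add_const 1
    refine tendsto_of_tendsto_of_tendsto_of_le_of_le' tendsto_const_nhds hup ?_ ?_
    · filter_upwards [eventually_ge_atTop 2] with n hn
      have hn' : (2 : ℝ) ≤ n := by exact_mod_cast hn
      have : 0 < Real.log n := Real.log_pos (by linarith)
      rw [le_div_iff₀ this, one_mul]
      exact Real.log_le_log (by linarith) (by push_cast; linarith)
    · filter_upwards [eventually_ge_atTop 2] with n hn
      have hn' : (2 : ℝ) ≤ n := by exact_mod_cast hn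
      have : 0 < Real.log n := Real.log_pos (by linarith)
      rw [div_add_one this.ne', ← Real.log_mul (by norm_num) (by linarith)]
      gcongr
      push_cast
      linarith
  simpa using h.inv₀ one_ne_zero

/-- hyperscaling inequality for the critical exponents: if at `p = p_c`
the critical exponents `ρ, η, ν` exist, i.e. `θ_t ≈ t^{-ρ}`, `χ_t ≈ t^η`, `ξ_t ≈ t^ν`
in the sense of convergence of ratios of logarithms, then `d ν ≥ η + 2 ρ`. -/
theorem hyperscaling_inequality (d : ℕ) (hd : 1 ≤ d) (ρ η ν : ℝ)
    (hρ : Filter.Tendsto (fun t : ℕ => -Real.log (theta d (pc d) t) / Real.log t)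
      Filter.atTop (nhds ρ))
    (hη : Filter.Tendsto (fun t : ℕ => Real.log (chi d (pc d) t) / Real.log t)
      Filter.atTop (nhds η))
    (hν : Filter.Tendsto (fun t : ℕ => Real.log (xi d (pc d) t) / Real.log t)
      Filter.atTop (nhds ν)) :
    η + 2 * ρ ≤ (d : ℝ) * ν := by
  set p := pc d with hp
  by_cases hz : ∃ t0, theta d p t0 = 0
  · obtain ⟨t0, ht0⟩ := hz
    have hth : ∀ t, t0 ≤ t → theta d p t = 0 := fun t ht =>
      le_antisymm ((theta_anti d p ht).trans ht0.le) (theta_nonneg _ _ _)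
    have hchi : ∀ t, t0 ≤ t → chi d p t = 0 := fun t ht => by
      rw [chi_eq]
      exact Finset.sum_eq_zero fun x _ =>
        le_antisymm ((tau_le_theta d p x t).trans (hth t ht).le) (tau_nonneg _ _ _ _)
    have hxi : ∀ t, t0 ≤ t → xi d p t = 0 := fun t ht => by
      unfold xi; rw [hchi t ht]; simp
    have e1 : ρ = 0 := tendsto_nhds_unique hρ (tendsto_const_nhds.congr' (by
      filter_upwards [eventually_ge_atTop t0] with t ht
      simp [hth t ht]))
    have e2 : η = 0 := tendsto_nhds_unique hη (tendsto_const_nhds.congr' (by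
      filter_upwards [eventually_ge_atTop t0] with t ht
      simp [hchi t ht]))
    have e3 : ν = 0 := tendsto_nhds_unique hν (tendsto_const_nhds.congr' (by
      filter_upwards [eventually_ge_atTop t0] with t ht
      simp [hxi t ht]))
    simp [e1, e2, e3]
  · push Not at hz
    have hpos : ∀ t, 0 < theta d p t := fun t => lt_of_le_of_ne (theta_nonneg _ _ _) (hz t).symm
    have l1 := hη.comp tendsto_odd
    have l2 := hν.comp tendsto_odd
    have l3 := hρ.mul tendsto_log_ratio
    have l4 := (tendsto_const_nhds (x := Real.log (2 * 5 ^ d))).div_atTop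
      (tendsto_log_nat.comp tendsto_odd)
    have l5 := (l4.add (l2.const_mul (d : ℝ))).sub (l3.const_mul 2)
    have hle := le_of_tendsto_of_tendsto l1 l5 (by
      filter_upwards [eventually_ge_atTop 2] with n hn
      have hn' : (2 : ℝ) ≤ n := by exact_mod_cast hn
      have hb := main_bound (hpos (n + (n + 1)))
      have hx := xi_ge_one (hpos (n + (n + 1)))
      have hc := (hpos (n + (n + 1))).trans_le (theta_le_chi _ _ _)
      have hl := Real.log_le_log hc hb
      have hxp : xi d p (n + (n + 1)) ^ d ≠ 0 := by positivity
      have htp : theta d p n ^ 2 ≠ 0 := pow_ne_zero _ (hpos n).ne'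
      have hk : (2 * 5 ^ d : ℝ) ≠ 0 := by positivity
      rw [Real.log_mul (mul_ne_zero hk hxp) htp, Real.log_mul hk hxp, Real.log_pow,
        Real.log_pow] at hl
      have hL : 0 < Real.log ((n + (n + 1) : ℕ) : ℝ) :=
        Real.log_pos (by push_cast; linarith)
      have hL2 : 0 < Real.log (n : ℝ) := Real.log_pos (by linarith)
      simp only [Function.comp_apply]
      rw [div_le_iff₀ hL]
      refine hl.trans (le_of_eq ?_)
      field_simp
      push_cast
      ring)
    linarith

end OrientedPercolation
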